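/- arXiv:1307.0292 — 4 statements merged into one kernel-verified Lean document; each statement's English description precedes it below -/
import Mathlib

section
/- Let K be a field of characteristic zero, R a K-algebra, Ω a commutative K-algebra, and ε : R → M_t(Ω) an injective K-algebra homomorphism such that tr(ε(r)) ∈ K for all r ∈ R. Then every matrix A ∈ M_n(R) satisfies a monic polynomial identity of degree tn with coefficients in K: A^{tn} + c_1 A^{tn-1} + ... + c_{tn-1} A + c_{tn} I_n = 0 for some c_1,...,c_{tn} ∈ K. -/
open Polynomial in
/-- The derivative of the determinant of a polynomial matrix is the sum over the columns of the
determinants with that column differentiated. -/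
theorem Matrix.derivative_det_eq_sum_updateCol {ι S : Type*} [Fintype ι] [DecidableEq ι]
    [CommRing S] (M : Matrix ι ι S[X]) :
    derivative M.det = ∑ i, (M.updateCol i fun j => derivative (M j i)).det := by
  simp only [Matrix.det_apply]
  rw [Finset.sum_comm, map_sum]
  refine Finset.sum_congr rfl fun σ _ => ?_
  rw [← Finset.smul_sum, Units.smul_def, Units.smul_def, derivative_smul,
    derivative_prod_finset]
  congr 1
  refine Finset.sum_congr rfl fun i _ => ?_
  rw [← Finset.prod_erase_mul _ _ (Finset.mem_univ i), Matrix.updateCol_self]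
  congr 1
  refine Finset.prod_congr rfl fun j hj => ?_
  rw [Matrix.updateCol_ne (Finset.ne_of_mem_erase hj)]

open Polynomial in
/-- The derivative of the characteristic polynomial is the trace of the adjugate of the
characteristic matrix. -/
theorem Matrix.derivative_charpoly_eq_trace_adjugate {ι S : Type*} [Fintype ι] [DecidableEq ι]
    [CommRing S] (M : Matrix ι ι S) :
    derivative M.charpoly = (Matrix.adjugate M.charmatrix).trace := by
  rw [Matrix.charpoly, Matrix.derivative_det_eq_sum_updateCol, Matrix.trace]
  refine Finset.sum_congr rfl fun i _ => ?_
  rw [Matrix.diag_apply, ← Matrix.transpose_apply (Matrix.adjugate _), Matrix.adjugate_transpose,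
    Matrix.adjugate_apply, Matrix.updateRow_transpose, Matrix.det_transpose]
  congr 2
  ext1 j
  by_cases h : j = i
  · subst h
    simp [Matrix.charmatrix_apply_eq]
  · simp [h]

open Polynomial in
/-- In characteristic zero, the coefficients of the characteristic polynomial lie in the base
field as soon as the traces of all powers do. -/
theorem Matrix.coeff_charpoly_mem_bot_of_trace_pow_mem {ι K S : Type*} [Fintype ι]
    [DecidableEq ι] [Field K] [CharZero K] [CommRing S] [Nontrivial S] [Algebra K S]
    (M : Matrix ι ι S) (h : ∀ m, (M ^ m).trace ∈ (⊥ : Subalgebra K S)) (k : ℕ) :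
    M.charpoly.coeff k ∈ (⊥ : Subalgebra K S) := by
  set B := matPolyEquiv (Matrix.adjugate M.charmatrix) with hB
  have hmul : (X - C M) * B = M.charpoly.map (algebraMap S (Matrix ι ι S)) := by
    rw [← matPolyEquiv_smul_one, Matrix.charpoly, ← Matrix.mul_adjugate, map_mul,
      matPolyEquiv_charmatrix]
  have hsucc (k : ℕ) :
      B.coeff k = algebraMap S _ (M.charpoly.coeff (k + 1)) + M * B.coeff (k + 1) := by
    have := congrArg (fun q => q.coeff (k + 1)) hmul
    simp only [sub_mul, coeff_sub, coeff_X_mul, coeff_C_mul, coeff_map] at this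
    rw [← this, sub_add_cancel]
  have hzero : algebraMap S _ (M.charpoly.coeff 0) + M * B.coeff 0 = 0 := by
    have := congrArg (fun q => q.coeff 0) hmul
    simp only [sub_mul, coeff_sub, coeff_X_mul_zero, coeff_C_mul, coeff_map] at this
    rw [← this, zero_sub, neg_add_cancel]
  have htrace (k : ℕ) : (B.coeff k).trace = M.charpoly.coeff (k + 1) * (k + 1) := by
    rw [← coeff_derivative, M.derivative_charpoly_eq_trace_adjugate, Matrix.trace, Matrix.trace,
      finsetSum_coeff]
    simp only [Matrix.diag_apply, hB, matPolyEquiv_coeff_apply]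
  have hscalar (s : S) : (algebraMap S (Matrix ι ι S) s).trace = s * Fintype.card ι := by
    rw [Algebra.algebraMap_eq_smul_one, Matrix.trace_smul, Matrix.trace_one, smul_eq_mul]
  have hnewton (k : ℕ) :
      ((Fintype.card ι : S) - k) * M.charpoly.coeff k = - (M * B.coeff k).trace := by
    cases k with
    | zero =>
      have := congrArg Matrix.trace hzero
      rw [Matrix.trace_add, hscalar, Matrix.trace_zero] at this
      push_cast
      linear_combination this
    | succ k =>
      have := congrArg Matrix.trace (hsucc k)
      rw [Matrix.trace_add, hscalar, htrace] at this
      push_cast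
      linear_combination -this
  have hdim := M.charpoly_natDegree_eq_dim
  suffices hk : M.charpoly.coeff k ∈ (⊥ : Subalgebra K S) ∧
      ∀ m, (M ^ m * B.coeff k).trace ∈ (⊥ : Subalgebra K S) from hk.1
  obtain ⟨N, hkN, hN, hBN⟩ : ∃ N, k ≤ N ∧ Fintype.card ι < N ∧ B.natDegree < N :=
    ⟨k + Fintype.card ι + B.natDegree + 1, by lia, by lia, by lia⟩
  induction hkN using Nat.decreasingInduction with
  | self =>
    rw [coeff_eq_zero_of_natDegree_lt (p := B) hBN,
      coeff_eq_zero_of_natDegree_lt (p := M.charpoly) (hdim ▸ hN)]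
    simp
  | of_succ j hj ih =>
    have htr (m : ℕ) : (M ^ m * B.coeff j).trace ∈ (⊥ : Subalgebra K S) := by
      rw [hsucc, mul_add, Matrix.trace_add, ← mul_assoc, ← pow_succ,
        Algebra.algebraMap_eq_smul_one, Matrix.mul_smul, mul_one, Matrix.trace_smul]
      exact add_mem (mul_mem ih.1 (h m)) (ih.2 (m + 1))
    refine ⟨?_, htr⟩
    by_cases hjd : j = Fintype.card ι
    · have : M.charpoly.coeff j = 1 := by
        rw [hjd, ← hdim]
        exact M.charpoly_monic
      rw [this]
      exact one_mem _
    · have hne : (Fintype.card ι : K) - j ≠ 0 :=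
        sub_ne_zero.2 fun e => hjd (by exact_mod_cast e.symm)
      have : M.charpoly.coeff j = ((Fintype.card ι : K) - j)⁻¹ • -(M ^ 1 * B.coeff j).trace := by
        rw [pow_one, ← hnewton, eq_inv_smul_iff₀ hne, Algebra.smul_def]
        simp
      rw [this]
      exact Subalgebra.smul_mem _ (neg_mem (htr 1)) _

/-- CT-representation Cayley–Hamilton: if `ε : R → M_t(Ω)` is an injective
`K`-algebra homomorphism with `tr (ε r)` a scalar from `K` for all `r`, then every
`A ∈ M_n(R)` satisfies a monic identity of degree `t * n` with coefficients in `K`. -/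
theorem stmt_0 (K R Ω : Type*) [Field K] [CharZero K] [Ring R] [Algebra K R]
    [CommRing Ω] [Algebra K Ω] (t n : ℕ)
    (ε : R →ₐ[K] Matrix (Fin t) (Fin t) Ω)
    (hinj : Function.Injective ε)
    (htr : ∀ r : R, ∃ k : K, Matrix.trace (ε r) = algebraMap K Ω k)
    (A : Matrix (Fin n) (Fin n) R) :
    ∃ c : Fin (t * n) → K,
      A ^ (t * n) + ∑ i : Fin (t * n), c i • A ^ (t * n - 1 - (i : ℕ)) = 0 := by
  cases subsingleton_or_nontrivial Ω with
  | inl hΩ =>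
    have : Subsingleton R := hinj.subsingleton
    exact ⟨0, Subsingleton.elim _ _⟩
  | inr hΩ =>
    let φ : Matrix (Fin n) (Fin n) R →ₐ[K] Matrix (Fin n × Fin t) (Fin n × Fin t) Ω :=
      (Matrix.compAlgEquiv (Fin n) (Fin t) Ω K).toAlgHom.comp ε.mapMatrix
    have hφ : Function.Injective φ :=
      (Matrix.compAlgEquiv (Fin n) (Fin t) Ω K).injective.comp (Matrix.map_injective hinj)
    have htrφ (B : Matrix (Fin n) (Fin n) R) : (φ B).trace ∈ (⊥ : Subalgebra K Ω) := by
      have : (φ B).trace = ∑ i, (ε (B i i)).trace := Fintype.sum_prod_type _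
      rw [this]
      refine sum_mem fun i _ => ?_
      obtain ⟨k, hk⟩ := htr (B i i)
      exact Algebra.mem_bot.2 ⟨k, hk.symm⟩
    have hcoeff (k : ℕ) : ∃ c : K, algebraMap K Ω c = (φ A).charpoly.coeff k :=
      Algebra.mem_bot.1 <| (φ A).coeff_charpoly_mem_bot_of_trace_pow_mem
        (fun m => map_pow φ A m ▸ htrφ (A ^ m)) k
    choose c hc using hcoeff
    have hdeg : (φ A).charpoly.natDegree = t * n := by
      rw [Matrix.charpoly_natDegree_eq_dim, Fintype.card_prod, Fintype.card_fin, Fintype.card_fin,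
        mul_comm]
    refine ⟨fun i => c (t * n - 1 - i), hφ ?_⟩
    have hCH := (φ A).aeval_self_charpoly
    rw [Polynomial.aeval_eq_sum_range, Finset.sum_range_succ, Polynomial.coeff_natDegree,
      (φ A).charpoly_monic.leadingCoeff, one_smul, hdeg] at hCH
    rw [Fin.sum_univ_eq_sum_range (fun i => c (t * n - 1 - i) • A ^ (t * n - 1 - i)),
      Finset.sum_range_reflect (fun i => c i • A ^ i), map_add, map_sum, map_zero, add_comm,
      map_pow, ← hCH]
    congr 1
    refine Finset.sum_congr rfl fun i _ => ?_
    rw [map_smul, map_pow, ← hc, algebraMap_smul]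
end

section
/- Let ε : E^(m) → M_t(Ω) be an injective K-algebra homomorphism with tr(ε(g)) ∈ K for all g ∈ E^(m), where Ω is a commutative K-algebra. Then the map sending g + h·v_{m+1} (g,h ∈ E^(m)) to the 2×2 block matrix [[ε(g₀+g₁), ε(h₀+h₁)ẑ],[ε(h₀−h₁)ẑ, ε(g₀−g₁)]], where g = g₀+g₁ and h = h₀+h₁ are the even-odd decompositions and ẑ = z + (z²), is an injective K-algebra homomorphism E^(m+1) → M_{2t}(Ω[z]/(z²)) whose image matrices all have trace in K. -/
variable (K : Type*) [Field K] [CharZero K] (m : ℕ)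

/-- The linear embedding `K^m → K^{m+1}` (extension by zero). -/
noncomputable def extZero : (Fin m → K) →ₗ[K] (Fin (m + 1) → K) where
  toFun x := Fin.snoc x 0
  map_add' x y := by
    funext i
    refine Fin.lastCases ?_ (fun j => ?_) i <;> simp
  map_smul' c x := by
    funext i
    refine Fin.lastCases ?_ (fun j => ?_) i <;> simp

/-- The induced `K`-algebra embedding `E⁽ᵐ⁾ → E⁽ᵐ⁺¹⁾`. -/
noncomputable def embE : ExteriorAlgebra K (Fin m → K) →ₐ[K] ExteriorAlgebra K (Fin (m + 1) → K) :=
  ExteriorAlgebra.map (extZero K m)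

set_option linter.unusedSectionVars false

/-- The block-diagonal algebra homomorphism built from two matrix representations. -/
def fromBlocksDiagAlgHom {k E R n : Type*} [CommRing k] [Ring E] [Algebra k E] [CommRing R]
    [Algebra k R] [Fintype n] [DecidableEq n] (φ ψ : E →ₐ[k] Matrix n n R) :
    E →ₐ[k] Matrix (n ⊕ n) (n ⊕ n) R where
  toFun g := Matrix.fromBlocks (φ g) 0 0 (ψ g)
  map_one' := by simp
  map_mul' x y := by simp [Matrix.fromBlocks_multiply]
  map_zero' := by simp
  map_add' x y := by simp [Matrix.fromBlocks_add]
  commutes' c := by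
    ext (i | i) (j | j) <;> simp [Matrix.algebraMap_matrix_apply]

theorem exists_eq_extZero_add_smul_single (x : Fin (m + 1) → K) :
    ∃ (y : Fin m → K) (c : K), x = extZero K m y + c • Pi.single (Fin.last m) 1 := by
  refine ⟨Fin.init x, x (Fin.last m), ?_⟩
  funext i
  refine Fin.lastCases ?_ (fun j => ?_) i <;> simp [extZero, Fin.init]

theorem embE_ι (y : Fin m → K) :
    embE K m (ExteriorAlgebra.ι K y) = ExteriorAlgebra.ι K (extZero K m y) := by
  simp [embE]

theorem exists_eq_embE_add_embE_mul_ι (u : ExteriorAlgebra K (Fin (m + 1) → K)) :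
    ∃ g h, u = embE K m g + embE K m h * ExteriorAlgebra.ι K (Pi.single (Fin.last m) 1) := by
  induction u using CliffordAlgebra.right_induction with
  | algebraMap r => exact ⟨algebraMap K _ r, 0, by simp⟩
  | add x y hx hy =>
    obtain ⟨g, h, rfl⟩ := hx
    obtain ⟨g', h', rfl⟩ := hy
    exact ⟨g + g', h + h', by simp only [map_add, add_mul]; abel⟩
  | mul_ι x w hw =>
    obtain ⟨g, h, rfl⟩ := hw
    obtain ⟨y, c, rfl⟩ := exists_eq_extZero_add_smul_single K m x
    refine ⟨g * ExteriorAlgebra.ι K y, c • g - h * ExteriorAlgebra.ι K y, ?_⟩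
    change _ * ExteriorAlgebra.ι K _ = _
    set v : ExteriorAlgebra K (Fin (m + 1) → K) :=
      ExteriorAlgebra.ι K (Pi.single (Fin.last m) 1) with hv
    have hvv : v * v = 0 := ExteriorAlgebra.ι_sq_zero _
    have hswap : v * ExteriorAlgebra.ι K (extZero K m y) =
        -(ExteriorAlgebra.ι K (extZero K m y) * v) :=
      eq_neg_of_add_eq_zero_left (ExteriorAlgebra.ι_add_mul_swap _ _)
    simp only [map_add, map_sub, map_smul, map_mul, embE_ι, ← hv, mul_add, add_mul, sub_mul,
      mul_assoc, hswap, hvv, mul_smul_comm, smul_mul_assoc, mul_neg, mul_zero,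
      add_zero]
    abel

theorem exists_algHom_embE_eq {A : Type*} [Ring A] [Algebra K A]
    (φ : ExteriorAlgebra K (Fin m → K) →ₐ[K] A) (V : A) (hV : V * V = 0)
    (hswap : ∀ y, V * φ (ExteriorAlgebra.ι K y) = -(φ (ExteriorAlgebra.ι K y) * V)) :
    ∃ Φ : ExteriorAlgebra K (Fin (m + 1) → K) →ₐ[K] A,
      (∀ g, Φ (embE K m g) = φ g) ∧
      Φ (ExteriorAlgebra.ι K (Pi.single (Fin.last m) 1)) = V := by
  let f : (Fin (m + 1) → K) →ₗ[K] A :=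
    φ.toLinearMap ∘ₗ ExteriorAlgebra.ι K ∘ₗ LinearMap.funLeft K K Fin.castSucc +
      (LinearMap.proj (Fin.last m)).smulRight V
  have hfe (y : Fin m → K) : f (extZero K m y) = φ (ExteriorAlgebra.ι K y) := by
    have : (LinearMap.funLeft K K Fin.castSucc) (extZero K m y) = y := by
      funext i; simp [extZero, LinearMap.funLeft_apply]
    have h0 : extZero K m y (Fin.last m) = 0 := by simp [extZero]
    simp [f, this, h0]
  have hfs : f (Pi.single (Fin.last m) 1) = V := by
    have : (LinearMap.funLeft K K Fin.castSucc) (Pi.single (Fin.last m) (1 : K)) = 0 := by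
      funext i; simp [LinearMap.funLeft_apply]
    simp [f, this]
  have hf (x : Fin (m + 1) → K) : f x * f x = 0 := by
    obtain ⟨y, c, rfl⟩ := exists_eq_extZero_add_smul_single K m x
    have hy : φ (ExteriorAlgebra.ι K y) * φ (ExteriorAlgebra.ι K y) = 0 := by
      rw [← map_mul, ExteriorAlgebra.ι_sq_zero, map_zero]
    simp [hfe, hfs, mul_add, add_mul, hV, hy, hswap]
  refine ⟨ExteriorAlgebra.lift K ⟨f, hf⟩, fun g => ?_, by simp [hfs]⟩
  have : (ExteriorAlgebra.lift K ⟨f, hf⟩).comp (embE K m) = φ := by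
    ext1
    refine LinearMap.ext fun y => ?_
    simp [embE_ι, hfe]
  exact DFunLike.congr_fun this g

theorem exists_blockAlgHom {Ω R n : Type*} [CommRing Ω] [Algebra K Ω] [CommRing R] [Algebra K R]
    [Algebra Ω R] [IsScalarTower K Ω R] [Fintype n] [DecidableEq n]
    (ε : ExteriorAlgebra K (Fin m → K) →ₐ[K] Matrix n n Ω) (z : R) (hz : z * z = 0) :
    ∃ Φ : ExteriorAlgebra K (Fin (m + 1) → K) →ₐ[K] Matrix (n ⊕ n) (n ⊕ n) R,
      ∀ g h, Φ (embE K m g + embE K m h * ExteriorAlgebra.ι K (Pi.single (Fin.last m) 1)) =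
        Matrix.fromBlocks ((ε g).map (algebraMap Ω R)) (z • (ε h).map (algebraMap Ω R))
          (z • (ε (CliffordAlgebra.involute h)).map (algebraMap Ω R))
          ((ε (CliffordAlgebra.involute g)).map (algebraMap Ω R)) := by
  let φ : ExteriorAlgebra K (Fin m → K) →ₐ[K] Matrix n n R :=
    (IsScalarTower.toAlgHom K Ω R).mapMatrix.comp ε
  have hφ (g) : φ g = (ε g).map (algebraMap Ω R) := rfl
  obtain ⟨Φ, hΦ, hΦv⟩ := exists_algHom_embE_eq K m
    (fromBlocksDiagAlgHom φ (φ.comp CliffordAlgebra.involute))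
    (Matrix.fromBlocks 0 (z • 1) (z • 1) 0)
    (by simp [Matrix.fromBlocks_multiply, smul_smul, hz])
    (fun y => by
      have : CliffordAlgebra.involute (ExteriorAlgebra.ι K y) = -ExteriorAlgebra.ι K y :=
        CliffordAlgebra.involute_ι y
      simp [fromBlocksDiagAlgHom, Matrix.fromBlocks_multiply, Matrix.fromBlocks_neg, this])
  refine ⟨Φ, fun g h => ?_⟩
  simp [hΦ, hΦv, fromBlocksDiagAlgHom, Matrix.fromBlocks_multiply, Matrix.fromBlocks_add, hφ]

theorem trace_fromBlocks {R m n : Type*} [AddCommMonoid R] [Fintype m] [Fintype n]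
    (A : Matrix m m R) (B : Matrix m n R) (C : Matrix n m R) (D : Matrix n n R) :
    Matrix.trace (Matrix.fromBlocks A B C D) = Matrix.trace A + Matrix.trace D :=
  Fintype.sum_sum_type _

theorem quotient_X_sq_algebraMap_injective {Ω : Type*} [CommRing Ω] :
    Function.Injective (algebraMap Ω
      (Polynomial Ω ⧸ Ideal.span {(Polynomial.X : Polynomial Ω) ^ 2})) := by
  refine (injective_iff_map_eq_zero _).2 fun a ha => ?_
  change Ideal.Quotient.mk _ (Polynomial.C a) = 0 at ha
  rw [Ideal.Quotient.eq_zero_iff_mem, Ideal.mem_span_singleton, Polynomial.X_pow_dvd_iff] at ha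
  simpa using ha 0 (by norm_num)

theorem quotient_X_sq_eq_zero_of_X_mul_eq_zero {Ω : Type*} [CommRing Ω] {a : Ω}
    (ha : Ideal.Quotient.mk (Ideal.span {(Polynomial.X : Polynomial Ω) ^ 2}) Polynomial.X *
      algebraMap Ω (Polynomial Ω ⧸ Ideal.span {(Polynomial.X : Polynomial Ω) ^ 2}) a = 0) :
    a = 0 := by
  change Ideal.Quotient.mk _ Polynomial.X * Ideal.Quotient.mk _ (Polynomial.C a) = 0 at ha
  rw [← map_mul, Ideal.Quotient.eq_zero_iff_mem, Ideal.mem_span_singleton,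
    Polynomial.X_pow_dvd_iff] at ha
  simpa using ha 1 (by norm_num)

/-- Inductive construction of constant-trace representations: if
`ε : E⁽ᵐ⁾ → M_t(Ω)` is an injective `K`-algebra homomorphism with all traces scalars
from `K`, then the block assignment
`g + h·v_{m+1} ↦ [[ε(g₀+g₁), ε(h₀+h₁)ẑ],[ε(h₀−h₁)ẑ, ε(g₀−g₁)]]` (the even–odd
decompositions being encoded by the grading involution, so that `g₀+g₁ = g` and
`g₀−g₁ = involute g`) is an injective `K`-algebra homomorphism
`E⁽ᵐ⁺¹⁾ → M_{2t}(Ω[z]/(z²))` whose image matrices all have trace a scalar from `K`. -/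
theorem stmt_4 (Ω : Type*) [CommRing Ω] [Algebra K Ω] (t : ℕ)
    (ε : ExteriorAlgebra K (Fin m → K) →ₐ[K] Matrix (Fin t) (Fin t) Ω)
    (hinj : Function.Injective ε)
    (htr : ∀ g, ∃ k : K, Matrix.trace (ε g) = algebraMap K Ω k) :
    ∃ ε' : ExteriorAlgebra K (Fin (m + 1) → K) →ₐ[K]
        Matrix (Fin (2 * t)) (Fin (2 * t))
          (Polynomial Ω ⧸ Ideal.span {(Polynomial.X : Polynomial Ω) ^ 2}),
      Function.Injective ε' ∧
      (∀ u, ∃ k : K, Matrix.trace (ε' u) =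
        algebraMap K (Polynomial Ω ⧸ Ideal.span {(Polynomial.X : Polynomial Ω) ^ 2}) k) ∧
      (∀ g h : ExteriorAlgebra K (Fin m → K),
        ε' (embE K m g + embE K m h * ExteriorAlgebra.ι K (Pi.single (Fin.last m) 1)) =
          Matrix.submatrix
            (Matrix.fromBlocks
              ((ε g).map (algebraMap Ω _))
              ((Ideal.Quotient.mk (Ideal.span {(Polynomial.X : Polynomial Ω) ^ 2})
                  Polynomial.X) • ((ε h).map (algebraMap Ω _)))
              ((Ideal.Quotient.mk (Ideal.span {(Polynomial.X : Polynomial Ω) ^ 2})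
                  Polynomial.X) • ((ε (CliffordAlgebra.involute h)).map (algebraMap Ω _)))
              ((ε (CliffordAlgebra.involute g)).map (algebraMap Ω _)))
            ((finCongr (two_mul t)).trans finSumFinEquiv.symm)
            ((finCongr (two_mul t)).trans finSumFinEquiv.symm)) := by
  obtain ⟨Φ, hΦ⟩ := exists_blockAlgHom K m ε
    (Ideal.Quotient.mk (Ideal.span {(Polynomial.X : Polynomial Ω) ^ 2}) Polynomial.X)
    (by
      rw [← map_mul, ← pow_two, Ideal.Quotient.eq_zero_iff_mem]
      exact Ideal.mem_span_singleton_self _)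
  let e := (finCongr (two_mul t)).trans finSumFinEquiv.symm
  refine ⟨(Matrix.reindexAlgEquiv K _ e.symm).toAlgHom.comp Φ, ?_, fun u => ?_, fun g h => ?_⟩
  · refine (Matrix.reindexAlgEquiv K _ e.symm).injective.comp ?_
    refine (injective_iff_map_eq_zero Φ).2 fun u hu => ?_
    obtain ⟨g, h, rfl⟩ := exists_eq_embE_add_embE_mul_ι K m u
    rw [hΦ, ← Matrix.fromBlocks_zero, Matrix.fromBlocks_inj] at hu
    obtain ⟨hg, hh, -, -⟩ := hu
    have hg0 : g = 0 := by
      refine (injective_iff_map_eq_zero ε).1 hinj g (Matrix.ext fun i j => ?_)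
      refine (injective_iff_map_eq_zero _).1 quotient_X_sq_algebraMap_injective _ ?_
      exact congrFun (congrFun hg i) j
    have hh0 : h = 0 := by
      refine (injective_iff_map_eq_zero ε).1 hinj h (Matrix.ext fun i j => ?_)
      exact quotient_X_sq_eq_zero_of_X_mul_eq_zero (congrFun (congrFun hh i) j)
    simp [hg0, hh0]
  · obtain ⟨g, h, rfl⟩ := exists_eq_embE_add_embE_mul_ι K m u
    obtain ⟨k, hk⟩ := htr g
    obtain ⟨l, hl⟩ := htr (CliffordAlgebra.involute g)
    refine ⟨k + l, ?_⟩
    have htrace (M : Matrix (Fin t ⊕ Fin t) (Fin t ⊕ Fin t)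
        (Polynomial Ω ⧸ Ideal.span {(Polynomial.X : Polynomial Ω) ^ 2})) :
        Matrix.trace (Matrix.reindexAlgEquiv K _ e.symm M) = Matrix.trace M :=
      Equiv.sum_comp e fun i => M i i
    refine (htrace (Φ _)).trans ?_
    rw [hΦ, trace_fromBlocks, ← AddMonoidHom.map_trace, ← AddMonoidHom.map_trace, hk, hl,
      ← IsScalarTower.algebraMap_apply, ← IsScalarTower.algebraMap_apply, map_add]
  · exact congrArg (Matrix.reindex e.symm e.symm) (hΦ g h)
end

section
/- If ε : E^(m) → M_t(Ω) is an injective K-algebra homomorphism for some commutative K-algebra Ω and integers m, t ≥ 2, then m ≤ 2t − 1. -/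
open Polynomial

namespace Matrix

variable {n R : Type*} [Fintype n] [DecidableEq n] [CommRing R]

/-- Jacobi's formula for the determinant, one column at a time. -/
lemma derivative_det (M : Matrix n n R[X]) :
    derivative M.det = ∑ i, (M.updateCol i fun j => derivative (M j i)).det := by
  simp only [det_apply, map_sum]
  rw [Finset.sum_comm]
  refine Finset.sum_congr rfl fun σ _ => ?_
  rw [Units.smul_def, map_zsmul, derivative_prod_finset, Finset.smul_sum]
  refine Finset.sum_congr rfl fun i _ => ?_
  rw [Units.smul_def, ← Finset.prod_erase_mul _ _ (Finset.mem_univ i), updateCol_self]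
  congr 2
  refine Finset.prod_congr rfl fun j hj => ?_
  rw [updateCol_ne (Finset.ne_of_mem_erase hj)]

lemma derivative_charpoly (B : Matrix n n R) :
    derivative B.charpoly = (adjugate (charmatrix B)).trace := by
  rw [charpoly, derivative_det, trace]
  refine Finset.sum_congr rfl fun i _ => ?_
  have h : (fun j => derivative (charmatrix B j i)) = Pi.single i 1 := by
    ext1 j
    rcases eq_or_ne j i with rfl | hj
    · simp [charmatrix_apply_eq]
    · simp [hj]
  rw [h, ← cramer_apply, cramer_eq_adjugate_mulVec]
  simp

lemma trace_coeff_matPolyEquiv (M : Matrix n n R[X]) (k : ℕ) :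
    ((matPolyEquiv M).coeff k).trace = M.trace.coeff k := by
  simp [trace, matPolyEquiv_coeff_apply]

lemma X_sub_C_mul_matPolyEquiv_adjugate (B : Matrix n n R) :
    (X - C B) * matPolyEquiv (adjugate (charmatrix B)) =
      B.charpoly.map (algebraMap R (Matrix n n R)) := by
  rw [← matPolyEquiv_charmatrix, ← map_mul, mul_adjugate, ← matPolyEquiv_smul_one, charpoly]

/-- Newton's identities when all power sums vanish. -/
lemma pow_card_eq_zero_of_trace_pow_eq_zero [Nonempty n] [IsAddTorsionFree R]
    (B : Matrix n n R) (hB : ∀ j, (B ^ (j + 1)).trace = 0) :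
    B ^ Fintype.card n = 0 := by
  nontriviality R
  set p := B.charpoly with hp
  set Q := matPolyEquiv (adjugate (charmatrix B)) with hQ
  have hmul : (X - C B) * Q = p.map (algebraMap R (Matrix n n R)) :=
    X_sub_C_mul_matPolyEquiv_adjugate B
  have hrec (k : ℕ) : Q.coeff k = p.coeff (k + 1) • (1 : Matrix n n R) + B * Q.coeff (k + 1) := by
    have h := congrArg (fun q => coeff q (k + 1)) hmul
    simp only [sub_mul, coeff_sub, coeff_X_mul, coeff_C_mul, coeff_map,
      Algebra.algebraMap_eq_smul_one] at h
    rw [← h, sub_add_cancel]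
  have hzero : p.coeff 0 • (1 : Matrix n n R) = -(B * Q.coeff 0) := by
    have h := congrArg (fun q => coeff q 0) hmul
    simp only [sub_mul, coeff_sub, coeff_X_mul_zero, coeff_C_mul, coeff_map,
      Algebra.algebraMap_eq_smul_one] at h
    rw [← h, zero_sub]
  have htr (k d : ℕ) (hd : Q.natDegree < k + d) (j : ℕ) :
      (B ^ (j + 1) * Q.coeff k).trace = 0 := by
    induction d generalizing k j with
    | zero => rw [coeff_eq_zero_of_natDegree_lt (by simpa using hd), mul_zero, trace_zero]
    | succ d ih =>
      rw [hrec, mul_add, trace_add, mul_smul_comm, mul_one, trace_smul, hB, smul_zero, zero_add,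
        ← mul_assoc, ← pow_succ]
      exact ih (k + 1) (by omega) (j + 1)
  have htr' (k : ℕ) : (B * Q.coeff k).trace = 0 := by
    simpa using htr k (Q.natDegree + 1) (by omega) 0
  have hderiv (k : ℕ) : (Q.coeff k).trace = p.coeff (k + 1) * (k + 1) := by
    rw [hQ, trace_coeff_matPolyEquiv, ← derivative_charpoly, coeff_derivative]
  have hcoeff (k : ℕ) (hk : k < Fintype.card n) : p.coeff k = 0 := by
    cases k with
    | zero =>
      have h := congrArg trace hzero
      rw [trace_smul, trace_neg, htr', neg_zero, trace_one, smul_eq_mul, mul_comm,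
        ← nsmul_eq_mul] at h
      exact (smul_eq_zero.mp h).resolve_left Fintype.card_ne_zero
    | succ k =>
      have h := hderiv k
      rw [hrec, trace_add, htr', add_zero, trace_smul, trace_one, smul_eq_mul] at h
      obtain ⟨d, hd⟩ := Nat.exists_eq_add_of_lt hk
      have h' : (d + 1) • p.coeff (k + 1) = 0 := by
        rw [hd] at h
        rw [nsmul_eq_mul]
        push_cast at h ⊢
        linear_combination h
      exact (smul_eq_zero.mp h').resolve_left d.succ_ne_zero
  have hpX : p = X ^ Fintype.card n := by
    have hdeg : p.natDegree = Fintype.card n := charpoly_natDegree_eq_dim B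
    have hmonic : p.Monic := charpoly_monic B
    ext k
    rw [coeff_X_pow]
    rcases lt_trichotomy k (Fintype.card n) with hk | hk | hk
    · rw [hcoeff k hk, if_neg hk.ne]
    · rw [if_pos hk, hk, ← hdeg, hmonic.coeff_natDegree]
    · rw [if_neg hk.ne', coeff_eq_zero_of_natDegree_lt (hdeg ▸ hk)]
  simpa [← hp, hpX] using aeval_self_charpoly B

end Matrix

section Anticommuting

variable {A : Type*} [Ring A]

lemma add_pow_succ_of_commute_of_sq_eq_zero {x y : A} (hxy : Commute x y) (hy : y * y = 0)
    (k : ℕ) : (x + y) ^ (k + 1) = x ^ (k + 1) + (k + 1) • (x ^ k * y) := by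
  induction k with
  | zero => simp
  | succ k ih =>
    have h1 : x ^ k * y * x = x ^ (k + 1) * y := by
      rw [mul_assoc, ← hxy.eq, ← mul_assoc, pow_succ]
    rw [pow_succ, ih, add_mul, mul_add, mul_add, ← pow_succ, smul_mul_assoc, smul_mul_assoc, h1,
      mul_assoc (x ^ k), hy, mul_zero, smul_zero, add_zero, succ_nsmul (x ^ (k + 1) * y) (k + 1),
      add_assoc, add_comm (x ^ (k + 1) * y)]

lemma sum_pow_eq_factorial_smul_prod (c : ℕ → A) (hc : ∀ i j, Commute (c i) (c j))
    (hsq : ∀ i, c i * c i = 0) (n : ℕ) :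
    (∑ k ∈ Finset.range n, c k) ^ (n + 1) = 0 ∧
      (∑ k ∈ Finset.range n, c k) ^ n = n.factorial • ((List.range n).map c).prod := by
  induction n with
  | zero => simp
  | succ n ih =>
    obtain ⟨h0, h1⟩ := ih
    have hcomm : Commute (∑ k ∈ Finset.range n, c k) (c n) :=
      Commute.sum_left _ _ _ fun i _ => hc i n
    rw [Finset.sum_range_succ, add_pow_succ_of_commute_of_sq_eq_zero hcomm (hsq n),
      add_pow_succ_of_commute_of_sq_eq_zero hcomm (hsq n), pow_succ _ (n + 1), h0, h1]
    refine ⟨by simp, ?_⟩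
    rw [List.range_succ, List.map_append, List.prod_append, zero_add, Nat.factorial_succ,
      mul_smul, smul_mul_assoc]
    simp

variable {v : ℕ → A}

lemma commute_mul_of_anticommute (hv : ∀ i j, v i * v j = -(v j * v i)) (i j k : ℕ) :
    Commute (v i) (v j * v k) := by
  rw [Commute, SemiconjBy, ← mul_assoc, hv i j, neg_mul, mul_assoc, hv i k, mul_neg, neg_neg,
    mul_assoc]

lemma prod_ofFn_two_mul (v : ℕ → A) (n : ℕ) :
    (List.ofFn fun i : Fin (2 * n) => v i).prod =
      ((List.range n).map fun k => v (2 * k) * v (2 * k + 1)).prod := by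
  have h (m : ℕ) : (List.ofFn fun i : Fin m => v i) = (List.range m).map v :=
    List.ext_getElem (by simp) (by simp)
  rw [h]
  induction n with
  | zero => simp
  | succ n ih =>
    rw [Nat.mul_succ, List.range_succ, List.range_succ, List.range_succ]
    simp [ih]

end Anticommuting

/-- The case of the Amitsur–Levitzki theorem of pairwise anticommuting square-zero matrices. -/
lemma factorial_smul_prod_eq_zero_of_anticommute {n R : Type*} [Fintype n] [DecidableEq n]
    [Nonempty n] [CommRing R] [IsAddTorsionFree R] (v : ℕ → Matrix n n R)
    (hv : ∀ i j, v i * v j = -(v j * v i)) (hsq : ∀ i, v i * v i = 0) :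
    (Fintype.card n).factorial •
      (List.ofFn fun i : Fin (2 * Fintype.card n) => v i).prod = 0 := by
  set c : ℕ → Matrix n n R := fun k => v (2 * k) * v (2 * k + 1) with hc
  have hcomm (i j : ℕ) : Commute (v i) (c j) := commute_mul_of_anticommute hv _ _ _
  have hcc (i j : ℕ) : Commute (c i) (c j) := (hcomm _ j).mul_left (hcomm _ j)
  have hcsq (i : ℕ) : c i * c i = 0 := by
    change v (2 * i) * v (2 * i + 1) * c i = 0
    rw [mul_assoc, (hcomm _ i).eq, hc, mul_assoc (v _), hsq, mul_zero, mul_zero]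
  rw [prod_ofFn_two_mul, ← (sum_pow_eq_factorial_smul_prod c hcc hcsq _).2]
  refine Matrix.pow_card_eq_zero_of_trace_pow_eq_zero _ fun j => ?_
  set B := ∑ k ∈ Finset.range (Fintype.card n), c k with hB
  have hvB (i : ℕ) : Commute (v i) B := Commute.sum_right _ _ _ fun k _ => hcomm i k
  rw [pow_succ', hB, Finset.sum_mul, ← hB, Matrix.trace_sum]
  refine Finset.sum_eq_zero fun k _ => ?_
  have h : (c k * B ^ j).trace = -(c k * B ^ j).trace := by
    conv_lhs => rw [hc, mul_assoc, Matrix.trace_mul_comm, mul_assoc, ← ((hvB _).pow_right j).eq,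
      ← mul_assoc, hv, neg_mul, Matrix.trace_neg]
  have h2 : 2 • (c k * B ^ j).trace = 0 := by
    rw [two_nsmul]
    exact eq_neg_iff_add_eq_zero.mp h
  exact (smul_eq_zero.mp h2).resolve_left two_ne_zero

lemma ExteriorAlgebra.ιMulti_ne_zero_of_leftInverse {R M : Type*} [CommRing R] [Nontrivial R]
    [AddCommGroup M] [Module R M] {k : ℕ} (w : Fin k → M) (f : M →ₗ[R] Fin k → R)
    (hf : ∀ i, f (w i) = Pi.single i 1) : ExteriorAlgebra.ιMulti R k w ≠ 0 := by
  intro h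
  let g : ∀ i, M [⋀^Fin i]→ₗ[R] R :=
    Function.update (fun _ => 0) k (Matrix.detRowAlternating.compLinearMap f)
  have h1 := ExteriorAlgebra.liftAlternating_apply_ιMulti g w
  have h2 : (fun i => f (w i)) = (1 : Matrix (Fin k) (Fin k) R) := by
    ext i j
    rw [hf, Matrix.one_eq_pi_single]
  have h3 : g k w = 1 := by
    simp only [g, Function.update_self, AlternatingMap.compLinearMap_apply]
    exact (congrArg Matrix.det h2).trans Matrix.det_one
  rw [h, map_zero, h3] at h1
  exact zero_ne_one h1

/-- If `E⁽ᵐ⁾` embeds (as a `K`-algebra) into `t × t` matrices over a commutative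
`K`-algebra `Ω`, with `m, t ≥ 2`, then `m ≤ 2t − 1`. -/
theorem stmt_6 (K Ω : Type*) [Field K] [CharZero K] [CommRing Ω] [Algebra K Ω]
    (m t : ℕ) (hm : 2 ≤ m) (ht : 2 ≤ t)
    (ε : ExteriorAlgebra K (Fin m → K) →ₐ[K] Matrix (Fin t) (Fin t) Ω)
    (hinj : Function.Injective ε) :
    m ≤ 2 * t - 1 := by
  by_contra! hlt
  have hle : 2 * t ≤ m := by omega
  have : IsAddTorsionFree Ω := .of_isTorsionFree K Ω
  have : Nonempty (Fin t) := ⟨⟨0, by omega⟩⟩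
  let w : ℕ → Fin m → K := fun i => if h : i < m then Pi.single ⟨i, h⟩ 1 else 0
  have key := factorial_smul_prod_eq_zero_of_anticommute (fun i => ε (ExteriorAlgebra.ι K (w i)))
    (fun i j => by
      rw [← map_mul ε, ← map_mul ε, ← map_neg ε,
        eq_neg_of_add_eq_zero_left (ExteriorAlgebra.ι_add_mul_swap (w i) (w j))])
    (fun i => by rw [← map_mul ε, ExteriorAlgebra.ι_sq_zero, map_zero])
  rw [Fintype.card_fin] at key
  have hprod : (List.ofFn fun i : Fin (2 * t) => ε (ExteriorAlgebra.ι K (w i))).prod =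
      ε (ExteriorAlgebra.ιMulti K (2 * t) fun i => w i) := by
    rw [ExteriorAlgebra.ιMulti_apply, map_list_prod, List.map_ofFn]
    rfl
  rw [hprod, ← map_nsmul, map_eq_zero_iff ε hinj, ← Nat.cast_smul_eq_nsmul K] at key
  refine ExteriorAlgebra.ιMulti_ne_zero_of_leftInverse (fun i : Fin (2 * t) => w i)
    (LinearMap.funLeft K K (Fin.castLE hle)) (fun i => ?_)
    ((smul_eq_zero.mp key).resolve_left (Nat.cast_ne_zero.mpr t.factorial_ne_zero))
  ext j
  have hi : (i : ℕ) < m := by omega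
  simp [w, hi, LinearMap.funLeft_apply, Pi.single_apply, Fin.ext_iff]
end

section
/- The subalgebra E₀^(m)[v_m] of the Grassmann algebra E^(m) generated by the even part E₀^(m) together with v_m is commutative and has K-dimension 2^{m−1} + 2^{m−2} (for m ≥ 2). Consequently, if there is an injective K-algebra homomorphism E^(m) → M_t(K), then 3·2^{m−2} ≤ ⌊t²/4⌋ + 1. -/
open Module

/-- Gustafson's form of Schur's inequality for nilpotent commuting spaces. -/
theorem finrank_le_sq_div_four_of_commute_of_pow_eq_bot {K V : Type*} [Field K] [AddCommGroup V]
    [Module K V] [FiniteDimensional K V] (N : Submodule K (Module.End K V))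
    (hcomm : ∀ f ∈ N, ∀ g ∈ N, f * g = g * f) {k : ℕ} (hk : N ^ k = ⊥) :
    finrank K N ≤ finrank K V ^ 2 / 4 := by
  obtain ⟨U, hU⟩ := Submodule.exists_isCompl (N • (⊤ : Submodule K V))
  have hmem : ∀ f ∈ N, ∀ x : V, f x ∈ N • (⊤ : Submodule K V) := fun f hf x =>
    Submodule.smul_mem_smul (r := f) (n := x) hf Submodule.mem_top
  let Φ : N →ₗ[K] (U →ₗ[K] (N • (⊤ : Submodule K V) : Submodule K V)) :=
    { toFun := fun f => (f.1.comp U.subtype).codRestrict _ fun u => hmem f.1 f.2 u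
      map_add' := fun f g => rfl
      map_smul' := fun c f => rfl }
  have hΦ : Function.Injective Φ := by
    rw [injective_iff_map_eq_zero]
    rintro ⟨f, hf⟩ h0
    have hUf : U ≤ LinearMap.ker f := fun u hu => by
      have := congrArg Subtype.val (LinearMap.congr_fun h0 ⟨u, hu⟩)
      exact this
    have hker : N • LinearMap.ker f ≤ LinearMap.ker f := by
      refine Submodule.smul_le.2 fun g hg x hx => ?_
      have := LinearMap.congr_fun (hcomm f hf g hg) x
      simp only [Module.End.mul_apply, LinearMap.mem_ker.1 hx, map_zero] at this
      exact this
    have key : ∀ j : ℕ, (⊤ : Submodule K V) ≤ LinearMap.ker f ⊔ N ^ j • ⊤ := by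
      intro j
      induction j with
      | zero => rw [pow_zero, Submodule.one_smul]; exact le_sup_right
      | succ j ih =>
        calc (⊤ : Submodule K V) = N • ⊤ ⊔ U := hU.sup_eq_top.symm
          _ ≤ N • (LinearMap.ker f ⊔ N ^ j • ⊤) ⊔ LinearMap.ker f :=
            sup_le_sup (Submodule.smul_mono le_rfl ih) hUf
          _ ≤ LinearMap.ker f ⊔ N ^ (j + 1) • ⊤ := by
            rw [Submodule.smul_sup, ← Submodule.smul_assoc, smul_eq_mul, ← pow_succ']
            exact sup_le (sup_le_sup_right hker _) le_sup_left
    have := key k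
    rw [hk, Submodule.bot_smul, sup_bot_eq] at this
    exact Subtype.ext (LinearMap.ext fun x => this (Submodule.mem_top (x := x)))
  have h1 := LinearMap.finrank_le_finrank_of_injective hΦ
  rw [finrank_linearMap] at h1
  have h2 := Submodule.finrank_add_eq_of_isCompl hU
  rw [Nat.le_div_iff_mul_le (by norm_num), ← h2]
  nlinarith [four_mul_le_sq_add (finrank K U) (finrank K (N • (⊤ : Submodule K V) : Submodule K V))]

namespace ExteriorAlgebra

theorem finrank_eq_two_pow (K M : Type*) [Field K] [AddCommGroup M] [Module K M]
    [FiniteDimensional K M] : finrank K (ExteriorAlgebra K M) = 2 ^ finrank K M := by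
  rw [finrank_eq_card_basis (finBasis K M).ExteriorAlgebra, Fintype.card_finset, Fintype.card_fin]

instance finiteDimensional (K M : Type*) [Field K] [AddCommGroup M] [Module K M]
    [FiniteDimensional K M] : FiniteDimensional K (ExteriorAlgebra K M) :=
  (finBasis K M).ExteriorAlgebra.finiteDimensional_of_finite

section CommRing

variable {R M : Type*} [CommRing R] [AddCommGroup M] [Module R M]

variable (R M) in
/-- The even (`i = 0`) and odd (`i = 1`) parts of the exterior algebra. -/
abbrev evenOdd (i : ZMod 2) : Submodule R (ExteriorAlgebra R M) :=
  CliffordAlgebra.evenOdd (0 : QuadraticForm R M) i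

variable (R M) in
theorem isCompl_evenOdd : IsCompl (evenOdd R M 0) (evenOdd R M 1) :=
  CliffordAlgebra.evenOdd_isCompl (0 : QuadraticForm R M)

theorem mul_mem_evenOdd {i j : ZMod 2} {x y : ExteriorAlgebra R M} (hx : x ∈ evenOdd R M i)
    (hy : y ∈ evenOdd R M j) : x * y ∈ evenOdd R M (i + j) :=
  SetLike.mul_mem_graded (A := CliffordAlgebra.evenOdd (0 : QuadraticForm R M)) hx hy

theorem algebraMap_mem_evenOdd (r : R) : algebraMap R (ExteriorAlgebra R M) r ∈ evenOdd R M 0 :=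
  SetLike.algebraMap_mem_graded (CliffordAlgebra.evenOdd (0 : QuadraticForm R M)) r

/-- Even elements of the exterior algebra are central. -/
theorem commute_of_mem_even {x : ExteriorAlgebra R M}
    (hx : x ∈ evenOdd R M 0) (y : ExteriorAlgebra R M) :
    Commute x y := by
  have hι : ∀ v : M, Commute x (ι R v) := by
    intro v
    induction x, hx using CliffordAlgebra.even_induction with
    | algebraMap r => exact Algebra.commutes r _
    | add x y hx hy h1 h2 => exact h1.add_left h2
    | ι_mul_ι_mul a b x hx h =>
      refine Commute.mul_left ?_ h
      have h1 := eq_neg_of_add_eq_zero_left (ι_add_mul_swap (R := R) b v)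
      have h2 := eq_neg_of_add_eq_zero_left (ι_add_mul_swap (R := R) a v)
      change ι R a * ι R b * ι R v = ι R v * (ι R a * ι R b)
      rw [mul_assoc, h1, mul_neg, ← mul_assoc, h2, neg_mul, neg_neg, mul_assoc]
  induction y using ExteriorAlgebra.induction with
  | algebraMap r => exact (Algebra.commutes r x).symm
  | ι v => exact hι v
  | mul a b ha hb => exact ha.mul_right hb
  | add a b ha hb => exact ha.add_right hb

theorem contractLeft_mem_evenOdd (d : Dual R M) {i : ZMod 2} {x : ExteriorAlgebra R M}
    (hx : x ∈ evenOdd R M i) :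
    CliffordAlgebra.contractLeft d x ∈ evenOdd R M (i + 1) := by
  have hd : ∀ (y : ExteriorAlgebra R M) (a b : M),
      CliffordAlgebra.contractLeft d (ι R a * ι R b * y) =
        d a • (ι R b * y) - (d b • (ι R a * y) -
          ι R a * ι R b * CliffordAlgebra.contractLeft d y) := by
    intro y a b
    rw [mul_assoc, CliffordAlgebra.contractLeft_ι_mul, CliffordAlgebra.contractLeft_ι_mul,
      mul_sub, mul_smul_comm, mul_assoc]
  have hmul : ∀ {j l : ZMod 2} {a b : ExteriorAlgebra R M},
      a ∈ evenOdd R M j →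
      b ∈ evenOdd R M l →
      a * b ∈ evenOdd R M (l + j) := fun ha hb => by
    rw [add_comm]; exact mul_mem_evenOdd ha hb
  induction x, hx using CliffordAlgebra.evenOdd_induction with
  | range_ι_pow v h =>
    fin_cases i
    · obtain ⟨r, rfl⟩ := Submodule.mem_one.1 h
      simp
    · obtain ⟨w, rfl⟩ : v ∈ LinearMap.range (ι R) := by
        have h' : v ∈ LinearMap.range (ι R) ^ 1 := h
        rwa [pow_one] at h'
      rw [CliffordAlgebra.contractLeft_ι]
      exact algebraMap_mem_evenOdd _
  | add x y hx hy h1 h2 => rw [map_add]; exact add_mem h1 h2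
  | ι_mul_ι_mul a b x hx h =>
    rw [hd]
    refine sub_mem (Submodule.smul_mem _ _ ?_) (sub_mem (Submodule.smul_mem _ _ ?_) ?_)
    · exact hmul (CliffordAlgebra.ι_mem_evenOdd_one _ _) hx
    · exact hmul (CliffordAlgebra.ι_mem_evenOdd_one _ _) hx
    · simpa using hmul (CliffordAlgebra.ι_mul_ι_mem_evenOdd_zero _ _ _) h

theorem ι_mul_mem_evenOdd (v : M) {i : ZMod 2} {x : ExteriorAlgebra R M}
    (hx : x ∈ evenOdd R M i) :
    ι R v * x ∈ evenOdd R M (i + 1) := by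
  rw [add_comm]
  exact mul_mem_evenOdd (CliffordAlgebra.ι_mem_evenOdd_one _ v) hx

/-- The augmentation ideal is generated by the degree-one part. -/
theorem ker_algebraMapInv_le :
    LinearMap.ker (algebraMapInv (R := R) (M := M)).toLinearMap ≤ LinearMap.range (ι R) * ⊤ := by
  have h : ∀ x : ExteriorAlgebra R M,
      x - algebraMap R _ (algebraMapInv x) ∈ LinearMap.range (ι R) * (⊤ : Submodule R _) := by
    intro x
    induction x using CliffordAlgebra.left_induction with
    | algebraMap r => simp [(algebraMap_leftInverse M) r]
    | add x y hx hy => simpa [sub_add_sub_comm] using add_mem hx hy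
    | ι_mul x m hx =>
      have : algebraMapInv (ι R m) = (0 : R) := by simp [algebraMapInv]
      rw [map_mul, this, zero_mul, map_zero, sub_zero]
      exact Submodule.mul_mem_mul ⟨m, rfl⟩ Submodule.mem_top
  intro x hx
  have hx' : algebraMapInv x = (0 : R) := hx
  simpa [hx'] using h x

theorem top_mul_range_ι_le :
    (⊤ : Submodule R (ExteriorAlgebra R M)) * LinearMap.range (ι R) ≤ LinearMap.range (ι R) * ⊤ := by
  refine Submodule.mul_le.2 ?_
  rintro x - _ ⟨v, rfl⟩
  induction x using CliffordAlgebra.left_induction with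
  | algebraMap r =>
    rw [Algebra.commutes]
    exact Submodule.mul_mem_mul ⟨v, rfl⟩ Submodule.mem_top
  | add x y hx hy => rw [add_mul]; exact add_mem hx hy
  | ι_mul x m hx =>
    rw [mul_assoc]
    exact Submodule.mul_mem_mul ⟨m, rfl⟩ Submodule.mem_top

theorem ker_algebraMapInv_pow_le (k : ℕ) :
    LinearMap.ker (algebraMapInv (R := R) (M := M)).toLinearMap ^ k ≤ (⋀[R]^k M) * ⊤ := by
  induction k with
  | zero => simp
  | succ k ih =>
    calc _ ≤ ((⋀[R]^k M) * ⊤) * (LinearMap.range (ι R) * ⊤) := by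
          rw [pow_succ]; exact mul_le_mul' ih ker_algebraMapInv_le
      _ = (⋀[R]^k M) * (⊤ * LinearMap.range (ι R)) * ⊤ := by simp only [mul_assoc]
      _ ≤ (⋀[R]^k M) * (LinearMap.range (ι R) * ⊤) * ⊤ :=
        mul_le_mul' (mul_le_mul' le_rfl top_mul_range_ι_le) le_rfl
      _ = (⋀[R]^(k + 1) M) * (⊤ * ⊤) := by
        rw [exteriorPower, exteriorPower, pow_succ]; simp only [mul_assoc]
      _ ≤ (⋀[R]^(k + 1) M) * ⊤ := mul_le_mul' le_rfl le_top

end CommRing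

variable {K M : Type*} [Field K] [AddCommGroup M] [Module K M]

theorem ker_algebraMapInv_pow_eq_bot [FiniteDimensional K M] :
    LinearMap.ker (algebraMapInv (R := K) (M := M)).toLinearMap ^ (finrank K M + 1) = ⊥ := by
  have h : ⋀[K]^(finrank K M + 1) M = ⊥ := by
    rw [← Submodule.finrank_eq_zero (R := K), exteriorPower.finrank_eq]
    simp
  rw [eq_bot_iff]
  refine (ker_algebraMapInv_pow_le _).trans ?_
  rw [h, Submodule.bot_mul]

theorem finrank_map_add_finrank_inf_ker {V W : Type*} [AddCommGroup V] [Module K V]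
    [AddCommGroup W] [Module K W] [FiniteDimensional K V] (f : V →ₗ[K] W) (p : Submodule K V) :
    finrank K (p.map f) + finrank K (p ⊓ LinearMap.ker f : Submodule K V) = finrank K p := by
  rw [← LinearMap.finrank_range_add_finrank_ker (f.domRestrict p), LinearMap.range_domRestrict,
    LinearMap.ker_domRestrict, ← Submodule.finrank_map_subtype_eq, Submodule.map_comap_subtype]

/-- Exactness of left multiplication by a vector, compatibly with the parity grading. -/
theorem evenOdd_inf_ker_mulLeft_ι {v : M} {φ : Dual K M} (hφ : φ v = 1) (i : ZMod 2) :
    evenOdd K M i ⊓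
        LinearMap.ker (LinearMap.mulLeft K (ι K v)) =
      (evenOdd K M (i + 1)).map
        (LinearMap.mulLeft K (ι K v)) := by
  apply le_antisymm
  · rintro x ⟨hx, hvx⟩
    refine ⟨_, contractLeft_mem_evenOdd φ hx, ?_⟩
    have hvx' : ι K v * x = 0 := hvx
    have h := CliffordAlgebra.contractLeft_ι_mul φ v x
    rw [hφ, one_smul] at h
    rw [LinearMap.mulLeft_apply]
    have h0 : CliffordAlgebra.contractLeft φ (CliffordAlgebra.ι 0 v * x) = 0 := by
      rw [show CliffordAlgebra.ι 0 v * x = 0 from hvx', map_zero]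
    rw [h0] at h
    exact (sub_eq_zero.1 h.symm).symm
  · rintro _ ⟨x, hx, rfl⟩
    refine ⟨?_, ?_⟩
    · have h := ι_mul_mem_evenOdd v hx
      rwa [add_assoc, CharTwo.add_self_eq_zero, add_zero] at h
    · rw [SetLike.mem_coe, LinearMap.mem_ker, LinearMap.mulLeft_apply, LinearMap.mulLeft_apply, ← mul_assoc,
        ι_sq_zero, zero_mul]

theorem finrank_map_mulLeft_ι_le [FiniteDimensional K M] {v w : M} {ψ : Dual K M} (hv : ψ v = 0) (hw : ψ w = 1)
    (i : ZMod 2) :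
    finrank K ((evenOdd K M i).map
        (LinearMap.mulLeft K (ι K v))) ≤
      finrank K ((evenOdd K M (i + 1)).map
        (LinearMap.mulLeft K (ι K v))) := by
  let S : ExteriorAlgebra K M →ₗ[K] ExteriorAlgebra K M :=
    LinearMap.mulLeft K (ι K w) + CliffordAlgebra.contractLeft ψ
  have hSapp : ∀ x, S x = ι K w * x + CliffordAlgebra.contractLeft ψ x := fun x => rfl
  have hSS : ∀ x, S (S x) = x := by
    intro x
    have h := CliffordAlgebra.contractLeft_ι_mul ψ w x
    rw [hw, one_smul] at h
    simp only [hSapp, mul_add, map_add, ← mul_assoc, ι_sq_zero, zero_mul,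
      CliffordAlgebra.contractLeft_contractLeft, h]
    abel
  have hSinj : Function.Injective S := fun x y h => by rw [← hSS x, h, hSS]
  have hSv : ∀ x, S (ι K v * x) = ι K v * (-S x) := by
    intro x
    have h := CliffordAlgebra.contractLeft_ι_mul ψ v x
    rw [hv, zero_smul] at h
    have h2 := eq_neg_of_add_eq_zero_left (ι_add_mul_swap (R := K) w v)
    rw [hSapp, hSapp, h, ← mul_assoc, h2]
    noncomm_ring
  rw [(Submodule.equivMapOfInjective S hSinj _).finrank_eq]
  refine Submodule.finrank_mono ?_
  rintro _ ⟨_, ⟨x, hx, rfl⟩, rfl⟩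
  refine ⟨-S x, neg_mem ?_, (hSv x).symm⟩
  exact add_mem (ι_mul_mem_evenOdd w hx) (contractLeft_mem_evenOdd ψ hx)

theorem two_mul_finrank_even [FiniteDimensional K M] {v : M} {φ : Dual K M} (hφ : φ v = 1) :
    2 * finrank K (evenOdd K M 0) = 2 ^ finrank K M := by
  have h0 := finrank_map_add_finrank_inf_ker (LinearMap.mulLeft K (ι K v))
    (evenOdd K M 0)
  have h1 := finrank_map_add_finrank_inf_ker (LinearMap.mulLeft K (ι K v))
    (evenOdd K M 1)
  rw [evenOdd_inf_ker_mulLeft_ι hφ] at h0 h1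
  rw [zero_add] at h0
  rw [CharTwo.add_self_eq_zero] at h1
  have h2 := Submodule.finrank_add_eq_of_isCompl
    (isCompl_evenOdd K M)
  have h3 := finrank_eq_two_pow K M
  omega

theorem two_mul_finrank_map_mulLeft_ι [FiniteDimensional K M] {v w : M} {φ ψ : Dual K M}
    (hφ : φ v = 1) (hv : ψ v = 0)
    (hw : ψ w = 1) :
    2 * finrank K ((evenOdd K M 0).map
      (LinearMap.mulLeft K (ι K v))) =
      finrank K (evenOdd K M 0) := by
  have h0 := finrank_map_add_finrank_inf_ker (LinearMap.mulLeft K (ι K v))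
    (evenOdd K M 0)
  rw [evenOdd_inf_ker_mulLeft_ι hφ, zero_add] at h0
  have h1 := finrank_map_mulLeft_ι_le hv hw 0
  have h2 := finrank_map_mulLeft_ι_le hv hw 1
  rw [zero_add] at h1
  rw [CharTwo.add_self_eq_zero] at h2
  omega

theorem toSubmodule_adjoin_even_union_ι (v : M) :
    Subalgebra.toSubmodule (Algebra.adjoin K
      ((evenOdd K M 0 : Set (ExteriorAlgebra K M)) ∪
        {ι K v})) =
      evenOdd K M 0 ⊔
        (evenOdd K M 0).map
          (LinearMap.mulLeft K (ι K v)) := by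
  have hone : (1 : ExteriorAlgebra K M) ∈ evenOdd K M 0 := by
    simpa using algebraMap_mem_evenOdd (M := M) (1 : K)
  apply le_antisymm
  · intro x hx
    rw [Subalgebra.mem_toSubmodule] at hx
    induction hx using Algebra.adjoin_induction with
    | mem x hx =>
      rcases hx with hx | rfl
      · exact Submodule.mem_sup_left hx
      · exact Submodule.mem_sup_right ⟨1, hone, by simp⟩
    | algebraMap r => exact Submodule.mem_sup_left (algebraMap_mem_evenOdd _)
    | add x y _ _ h1 h2 => exact add_mem h1 h2
    | mul x y _ _ h1 h2 =>
      obtain ⟨a, ha, _, ⟨b, hb, rfl⟩, rfl⟩ := Submodule.mem_sup.1 h1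
      obtain ⟨c, hc, _, ⟨d, hd, rfl⟩, rfl⟩ := Submodule.mem_sup.1 h2
      have hmul : ∀ {p q : ExteriorAlgebra K M},
          p ∈ evenOdd K M 0 →
          q ∈ evenOdd K M 0 →
          p * q ∈ evenOdd K M 0 := fun hp hq => by
        simpa using mul_mem_evenOdd hp hq
      refine Submodule.mem_sup.2 ⟨a * c, hmul ha hc, _,
        ⟨a * d + b * c, add_mem (hmul ha hd) (hmul hb hc), rfl⟩, ?_⟩
      have e1 : ι K v * b * (ι K v * d) = 0 := by
        rw [mul_assoc, ← mul_assoc b, (commute_of_mem_even hb (ι K v)).eq, mul_assoc,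
          ← mul_assoc, ι_sq_zero, zero_mul]
      have e2 : a * (ι K v * d) = ι K v * (a * d) := by
        rw [← mul_assoc, (commute_of_mem_even ha (ι K v)).eq, mul_assoc]
      simp only [LinearMap.mulLeft_apply, add_mul, mul_add, e1, e2, mul_assoc (ι K v) b c]
      abel
  · refine sup_le (fun x hx => Algebra.subset_adjoin (Or.inl hx)) ?_
    rintro _ ⟨x, hx, rfl⟩
    exact Subalgebra.mul_mem _ (Algebra.subset_adjoin (Or.inr rfl)) (Algebra.subset_adjoin (Or.inl hx))

theorem mul_comm_of_mem_adjoin_even_union_ι {v : M} {x y : ExteriorAlgebra K M}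
    (hx : x ∈ Algebra.adjoin K
      ((evenOdd K M 0 : Set (ExteriorAlgebra K M)) ∪ {ι K v}))
    (hy : y ∈ Algebra.adjoin K
      ((evenOdd K M 0 : Set (ExteriorAlgebra K M)) ∪ {ι K v})) :
    x * y = y * x := by
  have := Algebra.isMulCommutative_adjoin K (s :=
    (evenOdd K M 0 : Set (ExteriorAlgebra K M)) ∪ {ι K v}) (by
      rintro a (ha | rfl) b (hb | rfl)
      · exact commute_of_mem_even ha b
      · exact commute_of_mem_even ha _
      · exact (commute_of_mem_even hb _).symm
      · rfl)
  exact setLike_mul_comm hx hy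

theorem four_mul_finrank_adjoin_even_union_ι [FiniteDimensional K M] {v w : M} {φ ψ : Dual K M} (hφ : φ v = 1)
    (hv : ψ v = 0) (hw : ψ w = 1) :
    4 * finrank K (Algebra.adjoin K
      ((evenOdd K M 0 : Set (ExteriorAlgebra K M)) ∪
        {ι K v})) = 3 * 2 ^ finrank K M := by
  have h1 := two_mul_finrank_even hφ
  have h2 := two_mul_finrank_map_mulLeft_ι hφ hv hw
  rw [← Subalgebra.finrank_toSubmodule, toSubmodule_adjoin_even_union_ι]
  have hdisj : evenOdd K M 0 ⊓
      (evenOdd K M 0).map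
        (LinearMap.mulLeft K (ι K v)) = ⊥ := by
    rw [← disjoint_iff]
    refine (isCompl_evenOdd K M).disjoint.mono_right ?_
    rintro _ ⟨x, hx, rfl⟩
    simpa using ι_mul_mem_evenOdd v hx
  have h3 := Submodule.finrank_sup_add_finrank_inf_eq
    (evenOdd K M 0 : Submodule K (ExteriorAlgebra K M))
    ((evenOdd K M 0).map (LinearMap.mulLeft K (ι K v)))
  rw [hdisj, finrank_bot] at h3
  omega

/-- Schur's inequality for commutative subalgebras of an exterior algebra. -/
theorem finrank_le_of_injective_of_commute [FiniteDimensional K M]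
    (A : Subalgebra K (ExteriorAlgebra K M))
    (hA : ∀ x ∈ A, ∀ y ∈ A, x * y = y * x) {V : Type*} [AddCommGroup V] [Module K V]
    [FiniteDimensional K V] (l : ExteriorAlgebra K M →ₐ[K] Module.End K V)
    (hl : Function.Injective l) : finrank K A ≤ finrank K V ^ 2 / 4 + 1 := by
  set N := Subalgebra.toSubmodule A ⊓ LinearMap.ker (algebraMapInv (R := K) (M := M)).toLinearMap
    with hN
  have h1 := finrank_map_add_finrank_inf_ker
    (algebraMapInv (R := K) (M := M)).toLinearMap (Subalgebra.toSubmodule A)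
  have h2 := (Submodule.finrank_le ((Subalgebra.toSubmodule A).map
    (algebraMapInv (R := K) (M := M)).toLinearMap)).trans_eq (finrank_self K)
  have h3 := finrank_le_sq_div_four_of_commute_of_pow_eq_bot (N.map l.toLinearMap)
    (by
      rintro _ ⟨x, hx, rfl⟩ _ ⟨y, hy, rfl⟩
      change l x * l y = l y * l x
      rw [← map_mul, hA x hx.1 y hy.1, map_mul]) (k := finrank K M + 1)
    (by
      rw [← Submodule.map_pow, eq_bot_iff, ← Submodule.map_bot l.toLinearMap,
        ← ker_algebraMapInv_pow_eq_bot]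
      exact Submodule.map_mono (pow_le_pow_left' inf_le_right _))
  rw [← (Submodule.equivMapOfInjective l.toLinearMap hl N).finrank_eq] at h3
  rw [← hN] at h1
  rw [← Subalgebra.finrank_toSubmodule]
  omega

end ExteriorAlgebra

/-- The subalgebra `E₀⁽ᵐ⁾[v_m]` of `E⁽ᵐ⁾` generated by the even part together with
`v_m` is commutative of `K`-dimension `2^{m−1} + 2^{m−2}` (for `m ≥ 2`); consequently,
by Schur's inequality, any `K`-algebra embedding `E⁽ᵐ⁾ → M_t(K)` forces
`3·2^{m−2} ≤ ⌊t²/4⌋ + 1`. -/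
theorem stmt_13 (K : Type*) [Field K] [CharZero K] (m : ℕ) (hm : 2 ≤ m) :
    (∀ x ∈ Algebra.adjoin K
        ((CliffordAlgebra.evenOdd (0 : QuadraticForm K (Fin m → K)) 0 :
            Submodule K (ExteriorAlgebra K (Fin m → K))) ∪
          {ExteriorAlgebra.ι K ((Pi.single (⟨m - 1, by omega⟩ : Fin m) 1 : Fin m → K))}),
      ∀ y ∈ Algebra.adjoin K
        ((CliffordAlgebra.evenOdd (0 : QuadraticForm K (Fin m → K)) 0 :
            Submodule K (ExteriorAlgebra K (Fin m → K))) ∪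
          {ExteriorAlgebra.ι K ((Pi.single (⟨m - 1, by omega⟩ : Fin m) 1 : Fin m → K))}),
        x * y = y * x) ∧
    Module.finrank K
      (Algebra.adjoin K
        ((CliffordAlgebra.evenOdd (0 : QuadraticForm K (Fin m → K)) 0 :
            Submodule K (ExteriorAlgebra K (Fin m → K))) ∪
          {ExteriorAlgebra.ι K ((Pi.single (⟨m - 1, by omega⟩ : Fin m) 1 : Fin m → K))})) =
      2 ^ (m - 1) + 2 ^ (m - 2) ∧
    ∀ (t : ℕ) (l : ExteriorAlgebra K (Fin m → K) →ₐ[K] Matrix (Fin t) (Fin t) K),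
      Function.Injective l → 3 * 2 ^ (m - 2) ≤ t ^ 2 / 4 + 1 := by
  set v : Fin m → K := Pi.single (⟨m - 1, by omega⟩ : Fin m) 1 with hv
  have hne : (⟨0, by omega⟩ : Fin m) ≠ ⟨m - 1, by omega⟩ := by
    rw [Ne, Fin.mk.injEq]; omega
  have hdim := ExteriorAlgebra.four_mul_finrank_adjoin_even_union_ι (K := K) (v := v)
    (w := Pi.single (⟨0, by omega⟩ : Fin m) 1)
    (φ := LinearMap.proj (⟨m - 1, by omega⟩ : Fin m)) (ψ := LinearMap.proj (⟨0, by omega⟩ : Fin m))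
    (by simp [hv]) (by simp [hv, hne]) (by simp)
  rw [Module.finrank_fin_fun] at hdim
  obtain ⟨n, rfl⟩ : ∃ n, m = n + 2 := ⟨m - 2, by omega⟩
  have e1 : n + 2 - 1 = n + 1 := rfl
  have e2 : n + 2 - 2 = n := rfl
  rw [e1, e2]
  rw [pow_add] at hdim
  refine ⟨fun x hx y hy => ExteriorAlgebra.mul_comm_of_mem_adjoin_even_union_ι hx hy,
    Nat.eq_of_mul_eq_mul_left (by norm_num : 0 < 4) (hdim.trans (by ring)), ?_⟩
  · intro t l hl
    have h := ExteriorAlgebra.finrank_le_of_injective_of_commute _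
      (fun x hx y hy => ExteriorAlgebra.mul_comm_of_mem_adjoin_even_union_ι (v := v) hx hy)
      ((AlgEquiv.toAlgHom Matrix.toLinAlgEquiv').comp l)
      ((AlgEquiv.injective Matrix.toLinAlgEquiv').comp hl)
    rw [Module.finrank_fin_fun] at h
    omega
end
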